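/- arXiv:1109.5071 — 5 statements merged into one kernel-verified Lean document; each statement's English description precedes it below -/
import Mathlib

section
/- Let (Ω, 𝒜, P) be a probability space and X : Ω → ℝ a measurable function. Then for all real numbers k₁, k₂ with 0 < k₁ < k₂, the (possibly infinite) integral of A_{1/2}(|X|/k₁) with respect to P is at most (k₂/k₁)^(3/2) times the integral of A_{1/2}(|X|/k₂) with respect to P. -/
open MeasureTheory

/-- The function `A_{1/2}(x) = ∫₀^{|x|} √(log(1+s)) ds`. -/
noncomputable def Ahalf (x : ℝ) : ℝ := ∫ s in (0:ℝ)..|x|, Real.sqrt (Real.log (1 + s))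

lemma log_scale {c t : ℝ} (hc : 1 ≤ c) (ht : 0 ≤ t) :
    Real.log (1 + c * t) ≤ c * Real.log (1 + t) := by
  rw [← Real.log_rpow (by linarith)]
  exact Real.log_le_log (by positivity)
    (one_add_mul_self_le_rpow_one_add (by linarith) hc)

lemma integrable_aux (c y : ℝ) (hc : 0 ≤ c) (hy : 0 ≤ y) :
    IntervalIntegrable (fun s => Real.sqrt (Real.log (1 + c * s))) volume 0 y := by
  apply ContinuousOn.intervalIntegrable
  apply ContinuousOn.sqrt
  apply ContinuousOn.log
  · fun_prop
  · intro s hs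
    rw [Set.uIcc_of_le hy] at hs
    have := mul_nonneg hc hs.1
    linarith

lemma Ahalf_scale {c y : ℝ} (hc : 1 ≤ c) (hy : 0 ≤ y) :
    Ahalf (c * y) ≤ c ^ ((3 : ℝ) / 2) * Ahalf y := by
  have hc0 : 0 < c := by linarith
  unfold Ahalf
  rw [abs_of_nonneg (by positivity : 0 ≤ c * y), abs_of_nonneg hy]
  have h1 := intervalIntegral.mul_integral_comp_mul_left
    (f := fun s => Real.sqrt (Real.log (1 + s))) (a := 0) (b := y) c
  rw [mul_zero] at h1
  rw [← h1]
  have h2 : c ^ ((3 : ℝ) / 2) = c * Real.sqrt c := by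
    rw [Real.sqrt_eq_rpow, show (3 : ℝ) / 2 = 1 + 1 / 2 by norm_num,
      Real.rpow_add hc0, Real.rpow_one]
  rw [h2, mul_assoc]
  refine mul_le_mul_of_nonneg_left ?_ hc0.le
  rw [← intervalIntegral.integral_const_mul]
  refine intervalIntegral.integral_mono_on hy (integrable_aux c y hc0.le hy) ?_ ?_
  · have := integrable_aux 1 y zero_le_one hy
    simp only [one_mul] at this
    exact this.const_mul _
  · intro s hs
    rw [← Real.sqrt_mul hc0.le]
    exact Real.sqrt_le_sqrt (log_scale hc hs.1)

theorem stmt_1 {Ω : Type*} [MeasurableSpace Ω] (P : Measure Ω) [IsProbabilityMeasure P]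
    (X : Ω → ℝ) (hX : Measurable X) (k₁ k₂ : ℝ) (hk₁ : 0 < k₁) (hk : k₁ < k₂) :
    ∫⁻ ω, ENNReal.ofReal (Ahalf (|X ω| / k₁)) ∂P ≤
      ENNReal.ofReal ((k₂ / k₁) ^ ((3 : ℝ) / 2)) *
        ∫⁻ ω, ENNReal.ofReal (Ahalf (|X ω| / k₂)) ∂P := by
  have hk₂ : 0 < k₂ := hk₁.trans hk
  rw [← lintegral_const_mul' _ _ ENNReal.ofReal_ne_top]
  refine lintegral_mono fun ω => ?_
  rw [← ENNReal.ofReal_mul (by positivity)]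
  refine ENNReal.ofReal_le_ofReal ?_
  have h := Ahalf_scale (c := k₂ / k₁) (y := |X ω| / k₂)
    ((one_le_div hk₁).2 hk.le) (by positivity)
  rwa [show k₂ / k₁ * (|X ω| / k₂) = |X ω| / k₁ by field_simp] at h
end

section
/- For every real number v > 0 there exists a constant C > 0 with the following property: for every probability space (Ω, 𝒜, P) and all measurable functions X, Y : Ω → ℝ such that the law of Y under P is the Gaussian measure with mean 0 and variance v, and for every k > 0 such that ∫ A_{1/2}(|X|/k) dP ≤ 1, the product X·Y is P-integrable and ∫ |X·Y| dP ≤ C·k. -/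
open MeasureTheory ProbabilityTheory

lemma Ahalf_lower (x : ℝ) (hx : 0 ≤ x) :
    x / 2 * Real.sqrt (Real.log (1 + x / 2)) ≤ Ahalf x := by
  unfold Ahalf
  rw [abs_of_nonneg hx]
  have mono : ∀ s t : ℝ, 0 ≤ s → s ≤ t →
      Real.sqrt (Real.log (1 + s)) ≤ Real.sqrt (Real.log (1 + t)) := by
    intro s t hs hst
    exact Real.sqrt_le_sqrt (Real.log_le_log (by linarith) (by linarith))
  have ii : ∀ a b : ℝ, 0 ≤ a → a ≤ b →
      IntervalIntegrable (fun s => Real.sqrt (Real.log (1 + s))) volume a b := by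
    intro a b ha hab
    apply MonotoneOn.intervalIntegrable
    intro s hs t _ hst
    rw [Set.uIcc_of_le hab] at hs
    exact mono s t (ha.trans hs.1) hst
  rw [← intervalIntegral.integral_add_adjacent_intervals
    (ii 0 (x/2) le_rfl (by linarith)) (ii (x/2) x (by linarith) (by linarith))]
  have h1 : 0 ≤ ∫ s in (0:ℝ)..(x/2), Real.sqrt (Real.log (1 + s)) :=
    intervalIntegral.integral_nonneg (by linarith) (fun _ _ => Real.sqrt_nonneg _)
  have h2 : ∫ _ in (x/2)..x, Real.sqrt (Real.log (1 + x/2)) ≤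
      ∫ s in (x/2)..x, Real.sqrt (Real.log (1 + s)) := by
    apply intervalIntegral.integral_mono_on (by linarith) (by simp)
      (ii (x/2) x (by linarith) (by linarith))
    intro s hs
    exact mono _ _ (by linarith) hs.1
  rw [intervalIntegral.integral_const, smul_eq_mul] at h2
  have : x - x/2 = x/2 := by ring
  rw [this] at h2
  linarith

lemma young_Ahalf (c x y : ℝ) (hc : 0 < c) (hx : 0 ≤ x) (hy : 0 ≤ y) :
    x * y ≤ 2 * c * Ahalf x + 2 * c * Real.exp (2 * (y / c) ^ 2) := by
  have hA := Ahalf_lower x hx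
  have hA0 : 0 ≤ Ahalf x := le_trans (by positivity) hA
  by_cases h : y / c ≤ Real.sqrt (Real.log (1 + x / 2))
  · have h1 : y ≤ c * Real.sqrt (Real.log (1 + x / 2)) := by
      rw [div_le_iff₀ hc] at h; linarith
    have h2 : x * y ≤ 2 * c * Ahalf x := by
      calc x * y ≤ x * (c * Real.sqrt (Real.log (1 + x / 2))) := by gcongr
        _ = 2 * c * (x / 2 * Real.sqrt (Real.log (1 + x / 2))) := by ring
        _ ≤ _ := by gcongr
    have : 0 ≤ 2 * c * Real.exp (2 * (y / c) ^ 2) := by positivity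
    linarith
  · push Not at h
    set z := y / c with hz
    have hz0 : 0 < z := lt_of_le_of_lt (Real.sqrt_nonneg _) h
    have hyz : y = c * z := by rw [hz]; field_simp
    have h1 : Real.log (1 + x / 2) < z ^ 2 := (Real.sqrt_lt' hz0).1 h
    have h2 : 1 + x / 2 < Real.exp (z ^ 2) := (Real.log_lt_iff_lt_exp (by linarith)).1 h1
    have h3 : z ≤ Real.exp (z ^ 2) := by
      have := Real.add_one_le_exp (z ^ 2)
      nlinarith [sq_nonneg (z - 1)]
    have h4 : Real.exp (2 * z ^ 2) = Real.exp (z ^ 2) * Real.exp (z ^ 2) := by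
      rw [← Real.exp_add]; ring_nf
    have h5 : x * z ≤ (2 * Real.exp (z ^ 2)) * Real.exp (z ^ 2) := by
      apply mul_le_mul (by linarith) h3 hz0.le (by positivity)
    have h6 : x * y ≤ 2 * c * Real.exp (2 * z ^ 2) := by
      rw [h4, hyz]
      nlinarith
    have : 0 ≤ 2 * c * Ahalf x := by positivity
    linarith

lemma gauss_int (v : NNReal) (hv : 0 < v) (c : ℝ) (hc : c ^ 2 = 8 * v) :
    Integrable (fun y : ℝ => 2 * c * Real.exp (2 * (|y| / c) ^ 2)) (gaussianReal 0 v) := by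
  apply Integrable.const_mul
  have hv' : (0:ℝ) < v := hv
  rw [gaussianReal_of_var_ne_zero _ hv.ne',
    integrable_withDensity_iff (measurable_gaussianPDF _ _) (ae_of_all _ fun _ => by
      exact gaussianPDF_lt_top)]
  have h := (integrable_exp_neg_mul_sq (b := 1 / (4 * v)) (by positivity)).const_mul
    (Real.sqrt (2 * Real.pi * v))⁻¹
  refine h.congr (ae_of_all _ fun y => ?_)
  simp only [toReal_gaussianPDF, gaussianPDFReal, sub_zero]
  rw [mul_left_comm, ← Real.exp_add]
  congr 2
  rw [div_pow, hc, sq_abs]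
  field_simp
  ring

theorem stmt_5 (v : NNReal) (hv : 0 < v) :
    ∃ C : ℝ, 0 < C ∧
      ∀ (Ω : Type) (_ : MeasurableSpace Ω) (P : Measure Ω), IsProbabilityMeasure P →
        ∀ (X Y : Ω → ℝ), Measurable X → Measurable Y →
          Measure.map Y P = gaussianReal 0 v →
          ∀ k : ℝ, 0 < k →
            (∫⁻ ω, ENNReal.ofReal (Ahalf (|X ω| / k)) ∂P) ≤ 1 →
            Integrable (fun ω => X ω * Y ω) P ∧
              (∫ ω, |X ω * Y ω| ∂P) ≤ C * k := by
  have hv' : (0:ℝ) < v := hv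
  obtain ⟨c, hc, hc2⟩ : ∃ c : ℝ, 0 < c ∧ c ^ 2 = 8 * v :=
    ⟨Real.sqrt (8 * v), by positivity, Real.sq_sqrt (by positivity)⟩
  have hG := gauss_int v hv c hc2
  set G : ℝ → ℝ := fun y : ℝ => 2 * c * Real.exp (2 * (|y| / c) ^ 2) with hGdef
  have hG0 : ∀ y, 0 ≤ G y := fun y => by simp only [hGdef]; positivity
  have hGm : Measurable G := by simp only [hGdef]; fun_prop
  have hI0 : 0 ≤ ∫ y, G y ∂(gaussianReal 0 v) := integral_nonneg hG0
  refine ⟨2 * c + ∫ y, G y ∂(gaussianReal 0 v), by positivity, ?_⟩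
  intro Ω _ P _ X Y hX hY hlaw k hk hA
  have key : ∫⁻ ω, ENNReal.ofReal |X ω * Y ω| ∂P ≤
      ENNReal.ofReal ((2 * c + ∫ y, G y ∂(gaussianReal 0 v)) * k) := by
    have hpt : ∀ ω, ENNReal.ofReal |X ω * Y ω| ≤ ENNReal.ofReal k *
        (ENNReal.ofReal (2 * c) * ENNReal.ofReal (Ahalf (|X ω| / k))
          + ENNReal.ofReal (G (Y ω))) := by
      intro ω
      have hy := young_Ahalf c (|X ω| / k) |Y ω| hc (by positivity) (abs_nonneg _)
      have hA0 : 0 ≤ Ahalf (|X ω| / k) :=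
        le_trans (by positivity) (Ahalf_lower (|X ω| / k) (by positivity))
      rw [← ENNReal.ofReal_mul (by positivity), ← ENNReal.ofReal_add (by positivity) (hG0 _),
        ← ENNReal.ofReal_mul hk.le]
      apply ENNReal.ofReal_le_ofReal
      have e : |X ω * Y ω| = k * (|X ω| / k * |Y ω|) := by rw [abs_mul]; field_simp
      rw [e]
      exact mul_le_mul_of_nonneg_left hy hk.le
    have hGY : Measurable (fun ω => ENNReal.ofReal (G (Y ω))) := (hGm.comp hY).ennreal_ofReal
    refine (lintegral_mono hpt).trans ?_
    rw [lintegral_const_mul' _ _ ENNReal.ofReal_ne_top,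
      lintegral_add_right _ hGY,
      lintegral_const_mul' _ _ ENNReal.ofReal_ne_top]
    have e2 : ∫⁻ ω, ENNReal.ofReal (G (Y ω)) ∂P
        = ENNReal.ofReal (∫ y, G y ∂(gaussianReal 0 v)) := by
      rw [ofReal_integral_eq_lintegral_ofReal hG (ae_of_all _ hG0), ← hlaw,
        lintegral_map hGm.ennreal_ofReal hY]
    rw [e2, mul_comm _ k, ENNReal.ofReal_mul hk.le, ENNReal.ofReal_add (by positivity) hI0]
    gcongr
    exact mul_le_of_le_one_right' hA
  have hm : AEStronglyMeasurable (fun ω => X ω * Y ω) P := (hX.mul hY).aestronglyMeasurable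
  constructor
  · refine ⟨hm, ?_⟩
    rw [hasFiniteIntegral_iff_norm]
    exact lt_of_le_of_lt key ENNReal.ofReal_lt_top
  · have hma : AEStronglyMeasurable (fun ω => |X ω * Y ω|) P :=
      (hX.mul hY).abs.aestronglyMeasurable
    rw [integral_eq_lintegral_of_nonneg_ae (ae_of_all _ fun _ => abs_nonneg _) hma]
    exact ENNReal.toReal_le_of_le_ofReal (by positivity) key
end

section
/- Let (Ω, 𝒜, P) be a probability space and let (𝒢ₙ)_{n≥1} be an increasing sequence of sub-σ-algebras of 𝒜 whose union generates 𝒜. Let M : Ω → ℝ be integrable and suppose there exists k₀ > 0 such that A_{1/2}(M/k₀) is P-integrable. Then for every ε > 0, the sequence n ↦ ∫ A_{1/2}((E[M | 𝒢ₙ] − M)/ε) dP converges to 0 as n → ∞; that is, the closed martingale (E[M | 𝒢ₙ])_{n≥1} converges to M in the Orlicz space L log^{1/2} L(P). -/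
open MeasureTheory Filter

noncomputable def phiAux (s : ℝ) : ℝ := Real.sqrt (Real.log (1 + max s 0))

noncomputable def FAux (x : ℝ) : ℝ := ∫ s in (0:ℝ)..x, phiAux s

lemma phiAux_cont : Continuous phiAux := by
  unfold phiAux
  refine Real.continuous_sqrt.comp (Continuous.log (by fun_prop) ?_)
  intro x
  have := le_max_right x 0
  positivity

lemma phiAux_nonneg (s : ℝ) : 0 ≤ phiAux s := Real.sqrt_nonneg _

lemma phiAux_mono : Monotone phiAux := by
  intro a b h
  unfold phiAux
  apply Real.sqrt_le_sqrt
  have := le_max_right a 0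
  have h2 : max a 0 ≤ max b 0 := max_le_max_right 0 h
  exact Real.log_le_log (by linarith) (by linarith)

lemma phiAux_two (s : ℝ) : phiAux (2 * s) ≤ 2 * phiAux s := by
  unfold phiAux
  have h0 := le_max_right s 0
  have hm : max (2 * s) 0 = 2 * max s 0 := by
    rw [mul_max_of_nonneg _ _ (by norm_num : (0:ℝ) ≤ 2)]; simp
  rw [hm]
  set t := max s 0
  have hl : 0 ≤ Real.log (1 + t) := Real.log_nonneg (by linarith)
  have h1 : Real.log (1 + 2 * t) ≤ 2 * Real.log (1 + t) := by
    have : 2 * Real.log (1 + t) = Real.log ((1 + t) ^ 2) := by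
      rw [Real.log_pow]; norm_num
    rw [this]
    exact Real.log_le_log (by linarith) (by nlinarith)
  apply Real.sqrt_le_iff.2
  refine ⟨by positivity, ?_⟩
  rw [mul_pow, Real.sq_sqrt hl]
  linarith

lemma FAux_deriv (x : ℝ) : HasDerivAt FAux (phiAux x) x :=
  intervalIntegral.integral_hasDerivAt_right (phiAux_cont.intervalIntegrable _ _)
    (phiAux_cont.stronglyMeasurableAtFilter _ _) phiAux_cont.continuousAt

lemma FAux_zero : FAux 0 = 0 := by simp [FAux]

lemma FAux_mono : Monotone FAux := by
  apply monotone_of_deriv_nonneg (fun x => (FAux_deriv x).differentiableAt)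
  intro x
  rw [(FAux_deriv x).deriv]
  exact phiAux_nonneg x

lemma FAux_convex : ConvexOn ℝ Set.univ FAux := by
  apply Monotone.convexOn_univ_of_deriv (fun x => (FAux_deriv x).differentiableAt)
  have : deriv FAux = phiAux := funext fun x => (FAux_deriv x).deriv
  rw [this]
  exact phiAux_mono

lemma FAux_two (x : ℝ) (hx : 0 ≤ x) : FAux (2 * x) ≤ 4 * FAux x := by
  have hd : ∀ y, HasDerivAt (fun y => 4 * FAux y - FAux (2 * y))
      (4 * phiAux y - phiAux (2 * y) * 2) y := by
    intro y
    have h2 : HasDerivAt (fun y : ℝ => 2 * y) 2 y := by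
      simpa using (hasDerivAt_id y).const_mul 2
    exact ((FAux_deriv y).const_mul 4).sub ((FAux_deriv (2 * y)).comp y h2)
  have hm : Monotone (fun y => 4 * FAux y - FAux (2 * y)) := by
    apply monotone_of_deriv_nonneg (fun y => (hd y).differentiableAt)
    intro y
    rw [(hd y).deriv]
    have := phiAux_two y
    linarith
  have := hm hx
  simp only [mul_zero, FAux_zero] at this
  linarith

lemma Ahalf_eq (x : ℝ) : Ahalf x = FAux |x| := by
  unfold Ahalf FAux
  apply intervalIntegral.integral_congr
  intro s hs
  rw [Set.uIcc_of_le (abs_nonneg x)] at hs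
  simp only [phiAux, max_eq_left hs.1]

lemma Ahalf_zero : Ahalf 0 = 0 := by simp [Ahalf]

lemma Ahalf_cont : Continuous Ahalf := by
  have : Ahalf = fun x => FAux |x| := funext Ahalf_eq
  rw [this]
  have h : Continuous FAux := continuous_iff_continuousAt.2 fun x => (FAux_deriv x).continuousAt
  exact h.comp continuous_abs

lemma Ahalf_mono {x y : ℝ} (h : |x| ≤ |y|) : Ahalf x ≤ Ahalf y := by
  rw [Ahalf_eq, Ahalf_eq]; exact FAux_mono h

lemma Ahalf_nonneg (x : ℝ) : 0 ≤ Ahalf x := by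
  rw [← Ahalf_zero]; exact Ahalf_mono (by simp)

lemma Ahalf_two (x : ℝ) : Ahalf (2 * x) ≤ 4 * Ahalf x := by
  rw [Ahalf_eq, Ahalf_eq, abs_mul, abs_two]; exact FAux_two _ (abs_nonneg x)

lemma Ahalf_pow (j : ℕ) (x : ℝ) : Ahalf (2 ^ j * x) ≤ 4 ^ j * Ahalf x := by
  induction j with
  | zero => simp
  | succ j ih =>
    calc Ahalf (2 ^ (j + 1) * x) = Ahalf (2 * (2 ^ j * x)) := by ring_nf
      _ ≤ 4 * Ahalf (2 ^ j * x) := Ahalf_two _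
      _ ≤ 4 * (4 ^ j * Ahalf x) := by linarith
      _ = _ := by ring

lemma Ahalf_convex : ConvexOn ℝ Set.univ Ahalf := by
  refine ⟨convex_univ, ?_⟩
  intro x _ y _ a b ha hb hab
  rw [Ahalf_eq, Ahalf_eq, Ahalf_eq]
  refine le_trans (FAux_mono ?_) (FAux_convex.2 (Set.mem_univ |x|) (Set.mem_univ |y|) ha hb hab)
  simp only [smul_eq_mul]
  refine (abs_add_le _ _).trans ?_
  rw [abs_mul, abs_mul, abs_of_nonneg ha, abs_of_nonneg hb]

lemma Ahalf_neg (x : ℝ) : Ahalf (-x) = Ahalf x := by simp [Ahalf]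

theorem stmt_7 {Ω : Type*} {mΩ : MeasurableSpace Ω} (P : Measure Ω) [IsProbabilityMeasure P]
    (𝒢 : ℕ → MeasurableSpace Ω) (hmono : Monotone 𝒢) (hle : ∀ n, 𝒢 n ≤ mΩ)
    (hgen : (⨆ n, 𝒢 n) = mΩ)
    (M : Ω → ℝ) (hM : Integrable M P)
    (k₀ : ℝ) (hk₀ : 0 < k₀) (hA : Integrable (fun ω => Ahalf (M ω / k₀)) P) :
    ∀ ε : ℝ, 0 < ε →
      Tendsto (fun n => ∫ ω, Ahalf (((P[M | 𝒢 n]) ω - M ω) / ε) ∂P)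
        atTop (nhds 0) := by
  intro ε hε
  let ℱ : Filtration ℕ mΩ := ⟨𝒢, hmono, hle⟩
  -- limits of conditional expectations
  have hrep : ∀ Z : Ω → ℝ, Integrable Z P → P[Z | ⨆ n, 𝒢 n] =ᵐ[P] Z := by
    intro Z hZ
    rw [hgen]
    exact condExp_of_aestronglyMeasurable' le_rfl hZ.1 hZ
  have hae : ∀ᵐ ω ∂P, Tendsto (fun n => (P[M | 𝒢 n]) ω) atTop (nhds (M ω)) := by
    filter_upwards [tendsto_ae_condExp (μ := P) (ℱ := ℱ) M, hrep M hM] with ω h1 h2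
    rw [← h2]
    exact h1
  -- the scaled modular is integrable
  set Y : Ω → ℝ := fun ω => Ahalf ((2 / ε) * M ω) with hYdef
  have hY : Integrable Y P := by
    obtain ⟨j, hj⟩ := pow_unbounded_of_one_lt (2 / ε * k₀) (by norm_num : (1:ℝ) < 2)
    refine (hA.const_mul (4 ^ j)).mono'
      (Ahalf_cont.comp_aestronglyMeasurable (hM.1.const_mul _)) ?_
    refine Eventually.of_forall fun ω => ?_
    rw [Real.norm_of_nonneg (Ahalf_nonneg _)]
    refine le_trans (Ahalf_mono ?_) (Ahalf_pow j _)
    rw [abs_mul, abs_mul, abs_div (M ω), abs_of_pos hk₀, abs_of_pos (by positivity : 0 < 2 / ε),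
      abs_of_pos (by positivity : (0:ℝ) < 2 ^ j)]
    rw [← mul_div_assoc, le_div_iff₀ hk₀]
    nlinarith [abs_nonneg (M ω)]
  have hYL1 : Tendsto (fun n => ∫ ω, |(P[Y | 𝒢 n]) ω - Y ω| ∂P) atTop (nhds 0) := by
    have h1 := tendsto_eLpNorm_condExp (μ := P) (ℱ := ℱ) Y
    have h2 := (ENNReal.tendsto_toReal ENNReal.zero_ne_top).comp h1
    refine h2.congr fun n => ?_
    have h3 : eLpNorm (P[Y | ℱ n] - P[Y | ⨆ n, ℱ n]) 1 P = eLpNorm (P[Y | 𝒢 n] - Y) 1 P := by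
      apply eLpNorm_congr_ae
      filter_upwards [hrep Y hY] with ω h
      simp only [Pi.sub_apply]
      rw [← h]
    simp only [Function.comp, h3, ENNReal.toReal_zero]
    rw [eLpNorm_one_eq_lintegral_enorm, ← integral_norm_eq_lintegral_enorm]
    · rfl
    · exact (integrable_condExp.sub hY).1
  set f : ℕ → Ω → ℝ := fun n ω => Ahalf (((P[M | 𝒢 n]) ω - M ω) / ε) with hf
  have hfm : ∀ n, AEStronglyMeasurable (f n) P := fun n =>
    Ahalf_cont.comp_aestronglyMeasurable ((integrable_condExp.sub hM).div_const ε).1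
  have hbound : ∀ n, ∀ᵐ ω ∂P, f n ω ≤ ((P[Y | 𝒢 n]) ω + Y ω) / 2 := by
    intro n
    have hJ := Ahalf_convex.map_condExp_le_univ (μ := P) (hle n) Ahalf_cont.lowerSemicontinuous
      (f := fun ω => (2 / ε) * M ω) (hM.const_mul _) hY
    have hs := condExp_smul (μ := P) (2 / ε) M (𝒢 n)
    filter_upwards [hJ, hs] with ω h1 h2
    have h2' : (P[fun ω => (2 / ε) * M ω | 𝒢 n]) ω = (2 / ε) * (P[M | 𝒢 n]) ω := h2
    simp only [Function.comp] at h1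
    rw [h2'] at h1
    have h3 := Ahalf_convex.2 (Set.mem_univ ((2 / ε) * (P[M | 𝒢 n]) ω))
      (Set.mem_univ (-((2 / ε) * M ω))) (by norm_num : (0:ℝ) ≤ 1 / 2)
      (by norm_num : (0:ℝ) ≤ 1 / 2) (by norm_num)
    simp only [smul_eq_mul, Ahalf_neg] at h3
    have h4 : ((P[M | 𝒢 n]) ω - M ω) / ε
        = 1 / 2 * ((2 / ε) * (P[M | 𝒢 n]) ω) + 1 / 2 * (-((2 / ε) * M ω)) := by
      field_simp
      ring
    have h5 : Ahalf ((2 / ε) * (P[M | 𝒢 n]) ω) ≤ (P[Y | 𝒢 n]) ω := h1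
    simp only [hf, hYdef] at *
    rw [h4]
    linarith
  have hmin_int : ∀ n, Integrable (fun ω => min (f n ω) (Y ω)) P := by
    intro n
    refine hY.mono' ((hfm n).inf hY.1) (Eventually.of_forall fun ω => ?_)
    rw [Real.norm_of_nonneg (le_min (Ahalf_nonneg _) (Ahalf_nonneg _))]
    exact min_le_right _ _
  have hmin : Tendsto (fun n => ∫ ω, min (f n ω) (Y ω) ∂P) atTop (nhds 0) := by
    have : (0:ℝ) = ∫ ω, (0:ℝ) ∂P := by simp
    rw [this]
    refine tendsto_integral_of_dominated_convergence Y (fun n => (hmin_int n).1) hY ?_ ?_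
    · intro n
      refine Eventually.of_forall fun ω => ?_
      rw [Real.norm_of_nonneg (le_min (Ahalf_nonneg _) (Ahalf_nonneg _))]
      exact min_le_right _ _
    · filter_upwards [hae] with ω h
      have h1 : Tendsto (fun n => ((P[M | 𝒢 n]) ω - M ω) / ε) atTop (nhds 0) := by
        simpa using (h.sub_const (M ω)).div_const ε
      have h2 : Tendsto (fun n => f n ω) atTop (nhds 0) := by
        have := (Ahalf_cont.tendsto 0).comp h1
        rwa [Ahalf_zero] at this
      exact squeeze_zero (fun n => le_min (Ahalf_nonneg _) (Ahalf_nonneg _))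
        (fun n => min_le_left _ _) h2
  have hsum := hmin.add hYL1
  rw [add_zero] at hsum
  refine squeeze_zero (fun n => integral_nonneg fun ω => Ahalf_nonneg _) (fun n => ?_) hsum
  have hdi : Integrable (fun ω => |(P[Y | 𝒢 n]) ω - Y ω|) P := (integrable_condExp.sub hY).abs
  rw [← integral_add (hmin_int n) hdi]
  refine integral_mono_of_nonneg (Eventually.of_forall fun ω => Ahalf_nonneg _)
    ((hmin_int n).add hdi) ?_
  filter_upwards [hbound n] with ω h
  change f n ω ≤ min (f n ω) (Y ω) + |(P[Y | 𝒢 n]) ω - Y ω|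
  have h1 := le_abs_self ((P[Y | 𝒢 n]) ω - Y ω)
  have h2 := abs_nonneg ((P[Y | 𝒢 n]) ω - Y ω)
  rcases min_cases (f n ω) (Y ω) with ⟨h3, _⟩ | ⟨h3, _⟩ <;> rw [h3] <;> linarith
end

section
/- Let T > 0, Ω = C([0,T], ℝ) with its Borel σ-algebra, W_t(ω) = ω(t), and for 0 ≤ s ≤ T let ℱ_s be the σ-algebra generated by W_r, 0 ≤ r ≤ s. Let 𝒫 be the σ-algebra on Ω × [0,T] generated by the rectangles A × (s,t] with A ∈ ℱ_s, 0 ≤ s ≤ t ≤ T. Let P be a Borel probability measure and ν a finite positive Borel measure on Ω, let λ be Lebesgue measure on [0,T], let σ : Ω × [0,T] → ℝ be jointly measurable and (ν ⊗ λ)-integrable, and let H : Ω × [0,T] → ℝ be 𝒫-measurable and (P ⊗ λ)-integrable. Suppose that for every B ∈ 𝒫, ∫_B σ d(ν ⊗ λ) = ∫_B H d(P ⊗ λ) (i.e., the measure σ·(ν ⊗ λ) restricted to 𝒫 has density H with respect to (P ⊗ λ) restricted to 𝒫). Then for λ-almost every s ∈ [0,T] and every A ∈ ℱ_s, one has ∫_A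 σ(ω, s) dν(ω) = ∫_A H(ω, s) dP(ω). -/
open MeasureTheory

/-- The natural (uncompleted) filtration of the canonical process on `C([0,T], ℝ)`:
`ℱ_s` is generated by the evaluations `W_r`, `0 ≤ r ≤ s`. -/
def natFiltration (T s : ℝ) : MeasurableSpace C(Set.Icc (0:ℝ) T, ℝ) :=
  ⨆ r : Set.Icc (0:ℝ) T, ⨆ _ : (r : ℝ) ≤ s,
    MeasurableSpace.comap (fun ω : C(Set.Icc (0:ℝ) T, ℝ) => ω r) (borel ℝ)

/-- The strictly predictable σ-algebra on `Ω × [0,T]`, generated by the rectangles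
`A × (s,t]` with `A ∈ ℱ_s`. -/
def strictPredictable (T : ℝ) : MeasurableSpace (C(Set.Icc (0:ℝ) T, ℝ) × ℝ) :=
  MeasurableSpace.generateFrom
    {B | ∃ s t : ℝ, 0 ≤ s ∧ s ≤ t ∧ t ≤ T ∧
      ∃ A : Set C(Set.Icc (0:ℝ) T, ℝ), MeasurableSet[natFiltration T s] A ∧
        B = A ×ˢ Set.Ioc s t}


namespace Stmt11Aux

abbrev Om (T : ℝ) := C(Set.Icc (0:ℝ) T, ℝ)

/-- Cylinder sets with rational data. -/
def cyl (T : ℝ) (hT : 0 ≤ T) (F : Finset (ℚ × ℚ)) : Set (Om T) :=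
  {ω | ∀ p ∈ F, ω (Set.projIcc 0 T hT (p.1 : ℝ)) < (p.2 : ℝ)}

/-- The pi-system generating the filtration at time `s`. -/
def cylSys (T : ℝ) (hT : 0 ≤ T) (s : ℝ) : Set (Set (Om T)) :=
  {A | ∃ (q : ℚ) (F : Finset (ℚ × ℚ)), 0 ≤ q ∧ (q : ℝ) < s ∧ (∀ p ∈ F, p.1 ≤ q) ∧ A = cyl T hT F}

lemma cylSys_pi (T : ℝ) (hT : 0 ≤ T) (s : ℝ) : IsPiSystem (cylSys T hT s) := by
  rintro _ ⟨q, F, hq, hqs, hF, rfl⟩ _ ⟨q', F', hq', hqs', hF', rfl⟩ -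
  refine ⟨max q q', F ∪ F', le_max_of_le_left hq, ?_, ?_, ?_⟩
  · rcases le_total q q' with h | h
    · rwa [max_eq_right h]
    · rwa [max_eq_left h]
  · intro p hp
    rcases Finset.mem_union.1 hp with h | h
    · exact (hF p h).trans (le_max_left _ _)
    · exact (hF' p h).trans (le_max_right _ _)
  · ext ω
    simp only [cyl, Set.mem_inter_iff, Set.mem_ofPred_eq, Finset.mem_union]
    constructor
    · rintro ⟨h1, h2⟩ p (h | h)
      · exact h1 p h
      · exact h2 p h
    · intro h
      exact ⟨fun p hp => h p (Or.inl hp), fun p hp => h p (Or.inr hp)⟩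

lemma meas_cyl (T : ℝ) (hT : 0 ≤ T) (q : ℚ) (hq : 0 ≤ q) (F : Finset (ℚ × ℚ))
    (hF : ∀ p ∈ F, p.1 ≤ q) : MeasurableSet[natFiltration T q] (cyl T hT F) := by
  have : cyl T hT F = ⋂ p ∈ F, {ω : Om T | ω (Set.projIcc 0 T hT (p.1 : ℝ)) < (p.2 : ℝ)} := by
    ext ω; simp [cyl]
  rw [this]
  refine @Finset.measurableSet_biInter _ _ (natFiltration T q) _ F ?_
  intro p hp
  have hle : MeasurableSpace.comap
      (fun ω : Om T => ω (Set.projIcc 0 T hT (p.1 : ℝ))) (borel ℝ) ≤ natFiltration T q := by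
    unfold natFiltration
    refine le_iSup₂_of_le (Set.projIcc 0 T hT (p.1 : ℝ)) ?_ le_rfl
    have h1 : (p.1 : ℝ) ≤ q := by exact_mod_cast hF p hp
    have h2 : (0 : ℝ) ≤ q := by exact_mod_cast hq
    rw [Set.coe_projIcc]
    exact max_le h2 ((min_le_right _ _).trans h1)
  refine hle _ ⟨Set.Iio (p.2 : ℝ), ?_, rfl⟩
  rw [← BorelSpace.measurable_eq (α := ℝ)]
  exact measurableSet_Iio

lemma natFiltration_le_gen (T : ℝ) (hT : 0 ≤ T) (s : ℝ) (hs : 0 < s) :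
    natFiltration T s ≤ MeasurableSpace.generateFrom (cylSys T hT s) := by
  unfold natFiltration
  refine iSup₂_le fun r hr => ?_
  rw [← BorelSpace.measurable_eq (α := ℝ), ← measurable_iff_comap_le]
  obtain ⟨u, -, hu, hlim⟩ := Real.exists_seq_rat_strictMono_tendsto (r : ℝ)
  refine @measurable_of_tendsto_metrizable _ _ (MeasurableSpace.generateFrom (cylSys T hT s))
    _ _ _ _ (fun n ω => ω (Set.projIcc 0 T hT (u n : ℝ))) _ ?_ ?_
  · intro n
    rw [BorelSpace.measurable_eq (α := ℝ), Real.borel_eq_generateFrom_Iio_rat]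
    refine @measurable_generateFrom _ _ (MeasurableSpace.generateFrom (cylSys T hT s)) _ _ ?_
    intro t ht
    simp only [Set.mem_iUnion, Set.mem_singleton_iff] at ht
    obtain ⟨c, rfl⟩ := ht
    apply MeasurableSpace.measurableSet_generateFrom
    refine ⟨max 0 (u n), {(u n, c)}, le_max_left _ _, ?_, ?_, ?_⟩
    · have := hu n
      push_cast
      exact max_lt hs (this.trans_le hr)
    · intro p hp
      rw [Finset.mem_singleton] at hp
      subst hp
      exact le_max_right _ _
    · ext ω; simp [cyl]
  · rw [tendsto_pi_nhds]
    intro ω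
    have h := ((ω.continuous.comp (continuous_projIcc (h := hT))).tendsto (r : ℝ)).comp hlim
    simpa [Function.comp_def] using h

lemma meas_univ_prod (T : ℝ) (hT : 0 ≤ T) (S : Set ℝ) (hS : MeasurableSet S) :
    MeasurableSet[strictPredictable T] ((Set.univ : Set (Om T)) ×ˢ (S ∩ Set.Ioc 0 T)) := by
  have hI : ∀ t : ℝ, 0 ≤ t → t ≤ T →
      MeasurableSet[strictPredictable T] ((Set.univ : Set (Om T)) ×ˢ Set.Ioc 0 t) := by
    intro t h0 h1
    exact MeasurableSpace.measurableSet_generateFrom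
      ⟨0, t, le_rfl, h0, h1, Set.univ, @MeasurableSet.univ _ (natFiltration T 0), rfl⟩
  induction S, hS using MeasurableSpace.induction_on_inter
    (BorelSpace.measurable_eq.trans (borel_eq_generateFrom_Iic ℝ)) isPiSystem_Iic with
  | empty => simp
  | basic t ht =>
    obtain ⟨a, rfl⟩ := ht
    have : Set.Iic a ∩ Set.Ioc 0 T = Set.Ioc 0 (max 0 (min a T)) := by
      ext x
      simp only [Set.mem_inter_iff, Set.mem_Iic, Set.mem_Ioc, le_max_iff, le_min_iff]
      constructor
      · rintro ⟨h1, h2, h3⟩; exact ⟨h2, Or.inr ⟨h1, h3⟩⟩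
      · rintro ⟨h1, h2 | h2⟩
        · linarith
        · exact ⟨h2.1, h1, h2.2⟩
    rw [this]
    exact hI _ (le_max_left _ _) (max_le hT (min_le_right _ _))
  | compl t _ ih =>
    have : (Set.univ : Set (Om T)) ×ˢ (tᶜ ∩ Set.Ioc 0 T) =
        (Set.univ : Set (Om T)) ×ˢ Set.Ioc 0 T \ (Set.univ : Set (Om T)) ×ˢ (t ∩ Set.Ioc 0 T) := by
      ext ⟨x, y⟩
      simp only [Set.mem_prod, Set.mem_inter_iff, Set.mem_compl_iff, Set.mem_univ, true_and, Set.mem_sdiff]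
      tauto
    rw [this]
    exact @MeasurableSet.diff _ (strictPredictable T) _ _ (hI T hT le_rfl) ih
  | iUnion f _ _ ih =>
    have : (Set.univ : Set (Om T)) ×ˢ ((⋃ i, f i) ∩ Set.Ioc 0 T) =
        ⋃ i, (Set.univ : Set (Om T)) ×ˢ (f i ∩ Set.Ioc 0 T) := by
      rw [Set.iUnion_inter, Set.prod_iUnion]
    rw [this]
    exact @MeasurableSet.iUnion _ _ (strictPredictable T) _ _ ih

lemma meas_prod (T : ℝ) (hT : 0 ≤ T) (q : ℝ) (hq : 0 ≤ q) (A : Set (Om T))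
    (hA : MeasurableSet[natFiltration T q] A) (S : Set ℝ) (hS : MeasurableSet S) :
    MeasurableSet[strictPredictable T] (A ×ˢ (S ∩ Set.Ioc q T)) := by
  by_cases hqT : q ≤ T
  · have : A ×ˢ (S ∩ Set.Ioc q T) =
        A ×ˢ Set.Ioc q T ∩ (Set.univ : Set (Om T)) ×ˢ (S ∩ Set.Ioc 0 T) := by
      ext ⟨x, y⟩
      simp only [Set.mem_prod, Set.mem_inter_iff, Set.mem_Ioc, Set.mem_univ, true_and]
      constructor
      · rintro ⟨h1, h2, h3, h4⟩
        exact ⟨⟨h1, h3, h4⟩, h2, hq.trans_lt h3, h4⟩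
      · rintro ⟨⟨h1, h3, h4⟩, h2, -, -⟩
        exact ⟨h1, h2, h3, h4⟩
    rw [this]
    exact @MeasurableSet.inter _ (strictPredictable T) _ _
      (MeasurableSpace.measurableSet_generateFrom ⟨q, T, hq, hqT, le_rfl, A, hA, rfl⟩)
      (meas_univ_prod T hT S hS)
  · rw [Set.Ioc_eq_empty (fun h => hqT h.le), Set.inter_empty, Set.prod_empty]
    exact @MeasurableSet.empty _ (strictPredictable T)

lemma natFiltration_le (T s : ℝ) [MeasurableSpace (Om T)] [BorelSpace (Om T)] :
    natFiltration T s ≤ ‹MeasurableSpace (Om T)› := by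
  unfold natFiltration
  refine iSup₂_le fun r _ => ?_
  rw [← BorelSpace.measurable_eq (α := ℝ), ← measurable_iff_comap_le]
  exact (continuous_eval_const r).measurable

lemma int_slice {Ω : Type*} [MeasurableSpace Ω] (μ : Measure Ω) [IsFiniteMeasure μ]
    (L : Measure ℝ) [IsFiniteMeasure L] (f : Ω × ℝ → ℝ) (hf : Integrable f (μ.prod L))
    (A : Set Ω) (S : Set ℝ) :
    ∫ p in A ×ˢ S, f p ∂(μ.prod L) = ∫ u in S, ∫ ω in A, f (ω, u) ∂μ ∂L := by
  rw [← Measure.prod_restrict, integral_prod_symm]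
  rw [Measure.prod_restrict]
  exact hf.integrableOn

lemma integrable_slice {Ω : Type*} [MeasurableSpace Ω] (μ : Measure Ω) [IsFiniteMeasure μ]
    (L : Measure ℝ) [IsFiniteMeasure L] (f : Ω × ℝ → ℝ) (hf : Integrable f (μ.prod L))
    (A : Set Ω) : Integrable (fun u => ∫ ω in A, f (ω, u) ∂μ) L := by
  have : Integrable f ((μ.restrict A).prod L) := by
    have h := hf.integrableOn (s := A ×ˢ Set.univ)
    rwa [IntegrableOn, ← Measure.prod_restrict, Measure.restrict_univ] at h
  exact this.integral_prod_right

end Stmt11Aux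

open Stmt11Aux

theorem stmt_11 (T : ℝ) (hT : 0 < T)
    [MeasurableSpace C(Set.Icc (0:ℝ) T, ℝ)] [BorelSpace C(Set.Icc (0:ℝ) T, ℝ)]
    (P ν : Measure C(Set.Icc (0:ℝ) T, ℝ)) [IsProbabilityMeasure P] [IsFiniteMeasure ν]
    (σ' H : C(Set.Icc (0:ℝ) T, ℝ) × ℝ → ℝ)
    (hσmeas : Measurable σ')
    (hσint : Integrable σ' (ν.prod (volume.restrict (Set.Icc (0:ℝ) T))))
    (hHmeas : @Measurable _ _ (strictPredictable T) _ H)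
    (hHint : Integrable H (P.prod (volume.restrict (Set.Icc (0:ℝ) T))))
    (hdens : ∀ B : Set (C(Set.Icc (0:ℝ) T, ℝ) × ℝ), MeasurableSet[strictPredictable T] B →
      ∫ p in B, σ' p ∂(ν.prod (volume.restrict (Set.Icc (0:ℝ) T))) =
        ∫ p in B, H p ∂(P.prod (volume.restrict (Set.Icc (0:ℝ) T)))) :
    ∀ᵐ s ∂(volume.restrict (Set.Icc (0:ℝ) T)),
      ∀ A : Set C(Set.Icc (0:ℝ) T, ℝ), MeasurableSet[natFiltration T s] A →
        ∫ ω in A, σ' (ω, s) ∂ν = ∫ ω in A, H (ω, s) ∂P := by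
  set L := (volume.restrict (Set.Icc (0:ℝ) T) : Measure ℝ) with hL
  have key : ∀ (q : ℚ) (F : Finset (ℚ × ℚ)), 0 ≤ q → (∀ p ∈ F, p.1 ≤ q) →
      ∀ᵐ s ∂L, s ∈ Set.Ioc (q : ℝ) T →
        ∫ ω in cyl T hT.le F, σ' (ω, s) ∂ν = ∫ ω in cyl T hT.le F, H (ω, s) ∂P := by
    intro q F hq hF
    have hA := meas_cyl T hT.le q hq F hF
    rw [← ae_restrict_iff' measurableSet_Ioc]
    refine Integrable.ae_eq_of_forall_setIntegral_eq _ _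
      (integrable_slice ν L σ' hσint _).restrict (integrable_slice P L H hHint _).restrict ?_
    intro S hS _
    rw [Measure.restrict_restrict hS, ← int_slice ν L σ' hσint, ← int_slice P L H hHint]
    exact hdens _ (meas_prod T hT.le q (by exact_mod_cast hq) _ hA S hS)
  have key2 : ∀ᵐ s ∂L, ∀ (q : ℚ) (F : Finset (ℚ × ℚ)), 0 ≤ q → (∀ p ∈ F, p.1 ≤ q) →
      s ∈ Set.Ioc (q : ℝ) T →
        ∫ ω in cyl T hT.le F, σ' (ω, s) ∂ν = ∫ ω in cyl T hT.le F, H (ω, s) ∂P := by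
    simp_rw [ae_all_iff]
    exact key
  have h0 : ∀ᵐ s ∂L, s ≠ 0 := Measure.ae_ne L 0
  have hmem : ∀ᵐ s ∂L, s ∈ Set.Icc (0:ℝ) T := ae_restrict_mem measurableSet_Icc
  filter_upwards [key2, h0, hmem, hσint.prod_left_ae, hHint.prod_left_ae]
    with s hs hs0 hsm hσs hHs
  have hspos : 0 < s := lt_of_le_of_ne hsm.1 (Ne.symm hs0)
  have hle : MeasurableSpace.generateFrom (cylSys T hT.le s) ≤
      ‹MeasurableSpace C(Set.Icc (0:ℝ) T, ℝ)› := by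
    refine MeasurableSpace.generateFrom_le ?_
    rintro _ ⟨q, F, hq, -, hF, rfl⟩
    exact natFiltration_le T q _ (meas_cyl T hT.le q hq F hF)
  have huniv : ∫ ω, σ' (ω, s) ∂ν = ∫ ω, H (ω, s) ∂P := by
    have h := hs 0 ∅ le_rfl (by simp) ⟨by simpa using hspos, hsm.2⟩
    simpa [cyl] using h
  intro A hA
  have hA' := natFiltration_le_gen T hT.le s hspos A hA
  clear hA
  induction A, hA' using @MeasurableSpace.induction_on_inter _
    (MeasurableSpace.generateFrom (cylSys T hT.le s)) _ _ rfl (cylSys_pi T hT.le s) with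
  | empty => simp
  | basic t ht =>
    obtain ⟨q, F, hq, hqs, hF, rfl⟩ := ht
    exact hs q F hq hF ⟨hqs, hsm.2⟩
  | compl t ht ih =>
    rw [setIntegral_compl (hle _ ht) hσs, setIntegral_compl (hle _ ht) hHs, ih, huniv]
  | iUnion f hd hf ih =>
    rw [integral_iUnion (fun i => hle _ (hf i)) hd hσs.integrableOn,
      integral_iUnion (fun i => hle _ (hf i)) hd hHs.integrableOn]
    exact tsum_congr ih
end

section
/- Let (Ω, 𝒜, P) be a probability space, 𝒢 a sub-σ-algebra of 𝒜, G : Ω → ℝ a 𝒢-measurable random variable, and Z : Ω → ℝ a random variable independent of 𝒢 whose law is the Gaussian measure with mean 0 and variance v > 0, with density p(x) = exp(−x²/(2v))/√(2πv). Let u : Ω → ℝ be bounded and 𝒢-measurable, and let ψ : ℝ → ℝ be continuous with compact support. Then the function x ↦ E[u · p(x − G)] is continuous on ℝ, and E[ψ(G + Z) · u] = ∫_ℝ ψ(x) · E[u · p(x − G)] dx. -/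
open MeasureTheory ProbabilityTheory

theorem stmt_13_aux {Ω : Type*} {mΩ : MeasurableSpace Ω} (P : Measure Ω) [IsProbabilityMeasure P]
    (G : Ω → ℝ) (hG : Measurable G) (Z : Ω → ℝ) (hZ : Measurable Z)
    (v : NNReal) (hv : 0 < v) (hlaw : Measure.map Z P = gaussianReal 0 v)
    (u : Ω → ℝ) (hu : Measurable u) (hub : ∃ C, ∀ ω, |u ω| ≤ C)
    (hindep : IndepFun (fun ω => (G ω, u ω)) Z P)
    (ψ : ℝ → ℝ) (hψ : Continuous ψ) (hψc : HasCompactSupport ψ) :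
    Continuous (fun x : ℝ => ∫ ω, u ω *
        (Real.exp (-(x - G ω) ^ 2 / (2 * (v : ℝ))) / Real.sqrt (2 * Real.pi * (v : ℝ))) ∂P) ∧
    ∫ ω, ψ (G ω + Z ω) * u ω ∂P =
      ∫ x : ℝ, ψ x * ∫ ω, u ω *
        (Real.exp (-(x - G ω) ^ 2 / (2 * (v : ℝ))) / Real.sqrt (2 * Real.pi * (v : ℝ))) ∂P := by
  obtain ⟨C, hC⟩ := hub
  have hvR : (0 : ℝ) < v := by exact_mod_cast hv
  set K : ℝ := (Real.sqrt (2 * Real.pi * (v : ℝ)))⁻¹ with hK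
  have hK0 : 0 ≤ K := by positivity
  set p : ℝ → ℝ := fun y =>
    Real.exp (-y ^ 2 / (2 * (v : ℝ))) / Real.sqrt (2 * Real.pi * (v : ℝ)) with hp
  have hpc : Continuous p := by
    simp only [hp]
    fun_prop
  have hpb : ∀ y, |p y| ≤ K := by
    intro y
    have h1 : Real.exp (-y ^ 2 / (2 * (v : ℝ))) ≤ 1 := by
      apply Real.exp_le_one_iff.2
      apply div_nonpos_of_nonpos_of_nonneg
      · nlinarith [sq_nonneg y]
      · positivity
    rw [abs_of_nonneg (by simp only [hp]; positivity)]
    simp only [hp, div_eq_mul_inv]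
    rw [← hK]
    calc _ ≤ 1 * K := by
          apply mul_le_mul_of_nonneg_right _ hK0
          simpa [div_eq_mul_inv] using h1
      _ = K := one_mul _
  change Continuous (fun x : ℝ => ∫ ω, u ω * p (x - G ω) ∂P) ∧
    ∫ ω, ψ (G ω + Z ω) * u ω ∂P = ∫ x : ℝ, ψ x * ∫ ω, u ω * p (x - G ω) ∂P
  have hbound : ∀ x ω, ‖u ω * p (x - G ω)‖ ≤ C * K := by
    intro x ω
    rw [norm_mul]
    exact mul_le_mul (hC ω) (hpb _) (norm_nonneg _) ((abs_nonneg _).trans (hC ω))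
  refine ⟨?_, ?_⟩
  · refine continuous_of_dominated (bound := fun _ => C * K) ?_ ?_ (integrable_const _) ?_
    · intro x
      have := hpc.measurable
      exact (by fun_prop : Measurable fun ω => u ω * p (x - G ω)).aestronglyMeasurable
    · intro x
      exact Filter.Eventually.of_forall (hbound x)
    · refine Filter.Eventually.of_forall fun ω => ?_
      fun_prop
  · have hψi : Integrable ψ volume := hψ.integrable_of_hasCompactSupport hψc
    obtain ⟨M, hM⟩ := hψ.bounded_above_of_compact_support hψc
    have hψm := hψ.measurable
    have hpm := hpc.measurable
    have hW : Measurable (fun ω => (G ω, u ω)) := hG.prodMk hu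
    have hprob : IsProbabilityMeasure (P.map (fun ω => (G ω, u ω))) :=
      Measure.isProbabilityMeasure_map hW.aemeasurable
    have hmap := (indepFun_iff_map_prod_eq_prod_map_map hW.aemeasurable hZ.aemeasurable).1 hindep
    rw [hlaw] at hmap
    have hF : Measurable (fun q : (ℝ × ℝ) × ℝ => ψ (q.1.1 + q.2) * q.1.2) := by fun_prop
    have e1 : ∫ ω, ψ (G ω + Z ω) * u ω ∂P
        = ∫ q, ψ (q.1.1 + q.2) * q.1.2 ∂(P.map (fun ω => ((G ω, u ω), Z ω))) :=
      (integral_map (hW.prodMk hZ).aemeasurable hF.aestronglyMeasurable).symm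
    have hFi : Integrable (fun q : (ℝ × ℝ) × ℝ => ψ (q.1.1 + q.2) * q.1.2)
        (P.map (fun ω => ((G ω, u ω), Z ω))) := by
      rw [integrable_map_measure hF.aestronglyMeasurable (hW.prodMk hZ).aemeasurable]
      refine Integrable.of_bound (C := M * C)
        (hF.comp (hW.prodMk hZ)).aestronglyMeasurable ?_
      refine Filter.Eventually.of_forall fun ω => ?_
      simp only [Function.comp, norm_mul]
      exact mul_le_mul (hM _) (hC ω) (norm_nonneg _) ((norm_nonneg _).trans (hM 0))
    rw [hmap] at e1 hFi
    rw [e1, integral_prod _ hFi, integral_map hW.aemeasurable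
      hFi.integral_prod_left.aestronglyMeasurable]
    have e2 : ∀ ω, ∫ z, ψ (G ω + z) * u ω ∂(gaussianReal 0 v)
        = ∫ x, ψ x * (u ω * p (x - G ω)) := by
      intro ω
      rw [integral_gaussianReal_eq_integral_smul hv.ne',
        ← integral_add_left_eq_self (fun x => ψ x * (u ω * p (x - G ω))) (G ω)]
      refine integral_congr_ae (Filter.Eventually.of_forall fun z => ?_)
      simp only [gaussianPDFReal, hp, smul_eq_mul, sub_zero, add_sub_cancel_left]
      ring
    simp only [e2]
    rw [integral_integral_swap]
    · refine integral_congr_ae (Filter.Eventually.of_forall fun x => ?_)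
      exact integral_const_mul _ _
    · have hm : Measurable (fun q : Ω × ℝ => ψ q.2 * (u q.1 * p (q.2 - G q.1))) := by fun_prop
      have hi : Integrable (fun q : Ω × ℝ => (C * K) * ψ q.2) (P.prod volume) :=
        (integrable_const (C * K)).mul_prod hψi
      refine hi.mono hm.aestronglyMeasurable (Filter.Eventually.of_forall fun q => ?_)
      change ‖ψ q.2 * (u q.1 * p (q.2 - G q.1))‖ ≤ ‖(C * K) * ψ q.2‖
      rw [norm_mul (ψ q.2), norm_mul (C * K), mul_comm ‖ψ q.2‖]
      exact mul_le_mul_of_nonneg_right ((hbound _ _).trans (le_abs_self _)) (norm_nonneg _)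



theorem stmt_13 {Ω : Type*} {mΩ : MeasurableSpace Ω} (P : Measure Ω) [IsProbabilityMeasure P]
    (𝒢 : MeasurableSpace Ω) (h𝒢 : 𝒢 ≤ mΩ)
    (G : Ω → ℝ) (hG : @Measurable _ _ 𝒢 _ G)
    (Z : Ω → ℝ) (hZ : @Measurable _ _ mΩ _ Z)
    (v : NNReal) (hv : 0 < v)
    (hlaw : @Measure.map Ω ℝ mΩ _ Z P = gaussianReal 0 v)
    (hindep : Indep (MeasurableSpace.comap Z inferInstance) 𝒢 P)
    (u : Ω → ℝ) (hu : @Measurable _ _ 𝒢 _ u) (hub : ∃ C, ∀ ω, |u ω| ≤ C)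
    (ψ : ℝ → ℝ) (hψ : Continuous ψ) (hψc : HasCompactSupport ψ) :
    Continuous (fun x : ℝ => ∫ ω, u ω *
        (Real.exp (-(x - G ω) ^ 2 / (2 * (v : ℝ))) / Real.sqrt (2 * Real.pi * (v : ℝ))) ∂P) ∧
    ∫ ω, ψ (G ω + Z ω) * u ω ∂P =
      ∫ x : ℝ, ψ x * ∫ ω, u ω *
        (Real.exp (-(x - G ω) ^ 2 / (2 * (v : ℝ))) / Real.sqrt (2 * Real.pi * (v : ℝ))) ∂P := by
  refine stmt_13_aux P G (hG.mono h𝒢 le_rfl) Z hZ v hv hlaw u (hu.mono h𝒢 le_rfl) hub ?_ ψ hψ hψc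
  rw [IndepFun_iff_Indep]
  exact (indep_of_indep_of_le_right hindep (hG.prodMk hu).comap_le).symm
end
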